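/- arXiv:2604.08504 — 3 statements merged into one kernel-verified Lean document; each statement's English description precedes it below -/
import Mathlib

section
/- Let 𝓛 = {L_i}_{i∈ℕ} be a countable collection of infinite subsets of ℕ satisfying Angluin's condition, and let ε > 0. Then there exists a prefix-causal map A from input streams to probability measures on index streams that is ε-differentially private in the continual release model and identifies 𝓛 in the limit from stochastic inputs: for every index i and every probability distribution D on ℕ with support equal to L_i, ∫ A(x)({w : there exists N such that for all n ≥ N, L_{w(n)} = L_i}) d(D^⊗ℕ)(x) = 1, where D^⊗ℕ is the infinite product measure on ℕ → ℕ. -/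
open MeasureTheory

/-- Two streams are neighboring if they differ in exactly one coordinate. -/
def Neighboring (x x' : ℕ → ℕ) : Prop :=
  ∃ j, x j ≠ x' j ∧ ∀ m, m ≠ j → x m = x' m

/-- A continual-release algorithm is prefix-causal if streams agreeing on their
first `n` coordinates induce the same distribution on the first `n` outputs. -/
def PrefixCausal (A : (ℕ → ℕ) → Measure (ℕ → ℕ)) : Prop :=
  ∀ x x' : ℕ → ℕ, ∀ n : ℕ, (∀ m < n, x m = x' m) →
    (A x).map (fun w (m : Fin n) => w m.val) = (A x').map (fun w (m : Fin n) => w m.val)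

/-- ε-differential privacy in the continual release model. -/
def DPCR (ε : ℝ) (A : (ℕ → ℕ) → Measure (ℕ → ℕ)) : Prop :=
  ∀ x x' : ℕ → ℕ, Neighboring x x' → ∀ E : Set (ℕ → ℕ), MeasurableSet E →
    A x E ≤ ENNReal.ofReal (Real.exp ε) * A x' E

/-- An enumeration of a language `K`. -/
def IsEnumeration (K : Set ℕ) (e : ℕ → ℕ) : Prop :=
  (∀ n, e n ∈ K) ∧ ∀ y ∈ K, ∃ n, e n = y

/-- Angluin's condition: every language has a finite tell-tale. -/
def AngluinCondition (L : ℕ → Set ℕ) : Prop :=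
  ∀ i : ℕ, ∃ T : Finset ℕ, ↑T ⊆ L i ∧ ∀ j : ℕ, ↑T ⊆ L j → ¬ (L j ⊂ L i)

/-- `μ` is the law of an i.i.d. stream with marginal `D`, i.e. the infinite
product measure `D^⊗ℕ`: it is a probability measure whose value on every
cylinder set is the corresponding product of `D`-probabilities (this
characterizes `D^⊗ℕ` uniquely on the product σ-algebra). -/
def IsIIDStream (D : PMF ℕ) (μ : Measure (ℕ → ℕ)) : Prop :=
  IsProbabilityMeasure μ ∧
    ∀ (n : ℕ) (y : Fin n → ℕ),
      μ {x | ∀ m : Fin n, x m.val = y m} = ∏ m : Fin n, D (y m)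

/-- `A` identifies the collection `L` in the limit from stochastic inputs:
for every target index `i` and every distribution `D` supported exactly on
`L i`, on an i.i.d. input stream from `D` the output indices are, with overall
probability 1, eventually always correct. -/
def IdentifiesStochastically (L : ℕ → Set ℕ) (A : (ℕ → ℕ) → Measure (ℕ → ℕ)) :
    Prop :=
  ∀ (i : ℕ) (D : PMF ℕ), D.support = L i →
    ∀ μ : Measure (ℕ → ℕ), IsIIDStream D μ →
      ∫⁻ x, A x {w | ∃ N : ℕ, ∀ n ≥ N, L (w n) = L i} ∂μ = 1

open scoped ENNReal NNReal
open Filter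

/-! ### Consecutive blocks of coordinates -/

/-- The `b`-th block of natural numbers: those with integer square root `b`. -/
def sqrtBlock (b : ℕ) : Finset ℕ := Finset.Ico (b ^ 2) ((b + 1) ^ 2)

lemma mem_sqrtBlock {b m : ℕ} : m ∈ sqrtBlock b ↔ Nat.sqrt m = b := by
  rw [sqrtBlock, Finset.mem_Ico, ← Nat.le_sqrt', ← Nat.sqrt_lt', Nat.lt_succ_iff]
  omega

lemma card_sqrtBlock (b : ℕ) : (sqrtBlock b).card = 2 * b + 1 := by
  rw [sqrtBlock, Nat.card_Ico, Nat.sub_eq_iff_eq_add (by gcongr; omega)]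
  ring

/-- The last stage all of whose input coordinates are available at time `t`. -/
def stage (t : ℕ) : ℕ := Nat.sqrt (Nat.sqrt (t + 1)) - 1

lemma le_of_sqrt_sqrt_eq_stage {m t : ℕ} (h : Nat.sqrt (Nat.sqrt m) = stage t) : m ≤ t := by
  have h1 : 1 ≤ Nat.sqrt (Nat.sqrt (t + 1)) := by
    rw [Nat.le_sqrt', Nat.le_sqrt']
    omega
  have h2 : Nat.sqrt (Nat.sqrt m) < Nat.sqrt (Nat.sqrt (t + 1)) := by
    rw [h, stage]
    omega
  by_contra! hlt
  exact absurd (Nat.sqrt_le_sqrt (Nat.sqrt_le_sqrt hlt)) (not_le.2 h2)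

lemma tendsto_stage : Tendsto stage atTop atTop := by
  refine tendsto_atTop_atTop.2 fun b => ⟨((b + 1) ^ 2) ^ 2, fun t ht => ?_⟩
  have : b + 1 ≤ Nat.sqrt (Nat.sqrt (t + 1)) := by
    rw [Nat.le_sqrt', Nat.le_sqrt']
    omega
  rw [stage]
  omega

/-! ### The exponential mechanism on vote counts -/

/-- The number of voters in `s` whose vote under `y` is `j`. -/
def voteCount (s : Finset ℕ) (y : ℕ → ℕ) (j : ℕ) : ℕ := {b ∈ s | y b = j}.card

/-- The unnormalized weight of candidate `j` in the exponential mechanism on votes. -/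
noncomputable def voteWeight (c : ℝ≥0) (s : Finset ℕ) (y : ℕ → ℕ) (j : ℕ) : ℝ≥0∞ :=
  2⁻¹ ^ (j + 1) * (c : ℝ≥0∞) ^ voteCount s y j

lemma tsum_two_inv_pow_succ : ∑' j : ℕ, (2⁻¹ : ℝ≥0∞) ^ (j + 1) = 1 := by
  simp_rw [pow_succ]
  rw [ENNReal.tsum_mul_right, ENNReal.tsum_geometric_two]
  exact ENNReal.mul_inv_cancel (by norm_num) (by norm_num)

lemma tsum_voteWeight_ne_zero {c : ℝ≥0} (hc : 1 ≤ c) (s : Finset ℕ) (y : ℕ → ℕ) :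
    ∑' j, voteWeight c s y j ≠ 0 := by
  rw [Ne, ENNReal.tsum_eq_zero]
  intro h
  have := h 0
  have hc0 : c ≠ 0 := (zero_lt_one.trans_le hc).ne'
  simp [voteWeight, hc0] at this

lemma tsum_voteWeight_ne_top {c : ℝ≥0} (hc : 1 ≤ c) (s : Finset ℕ) (y : ℕ → ℕ) :
    ∑' j, voteWeight c s y j ≠ ∞ := by
  refine ne_top_of_le_ne_top (b := (c : ℝ≥0∞) ^ s.card) (by finiteness) ?_
  calc ∑' j, voteWeight c s y j ≤ ∑' j : ℕ, 2⁻¹ ^ (j + 1) * (c : ℝ≥0∞) ^ s.card := by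
        refine ENNReal.tsum_le_tsum fun j => ?_
        rw [voteWeight]
        gcongr
        · exact_mod_cast hc
        · exact Finset.card_filter_le _ _
    _ = (c : ℝ≥0∞) ^ s.card := by rw [ENNReal.tsum_mul_right, tsum_two_inv_pow_succ, one_mul]

/-- The exponential mechanism selecting a candidate from the votes `y b`, `b ∈ s`. -/
noncomputable def votePMF (c : ℝ≥0) (hc : 1 ≤ c) (s : Finset ℕ) (y : ℕ → ℕ) : PMF ℕ :=
  PMF.normalize (voteWeight c s y) (tsum_voteWeight_ne_zero hc s y) (tsum_voteWeight_ne_top hc s y)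

lemma votePMF_congr {c : ℝ≥0} (hc : 1 ≤ c) {s : Finset ℕ} {y y' : ℕ → ℕ}
    (h : ∀ b ∈ s, y b = y' b) : votePMF c hc s y = votePMF c hc s y' := by
  have : voteWeight c s y = voteWeight c s y' := by
    funext j
    rw [voteWeight, voteWeight, voteCount, voteCount,
      Finset.filter_congr fun b hb => by rw [h b hb]]
  simp only [votePMF, this]

lemma voteCount_le_succ {s : Finset ℕ} {y y' : ℕ → ℕ} {b₀ : ℕ} (h : ∀ b, b ≠ b₀ → y b = y' b)
    (j : ℕ) : voteCount s y j ≤ voteCount s y' j + 1 := by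
  refine (Finset.card_le_card (t := insert b₀ {b ∈ s | y' b = j}) fun b hb => ?_).trans
    (Finset.card_insert_le _ _)
  by_cases hbb : b = b₀
  · simp [hbb]
  · simp only [Finset.mem_filter, Finset.mem_insert] at hb ⊢
    exact Or.inr ⟨hb.1, h b hbb ▸ hb.2⟩

lemma voteWeight_le {c : ℝ≥0} (hc : 1 ≤ c) {s : Finset ℕ} {y y' : ℕ → ℕ} {b₀ : ℕ}
    (h : ∀ b, b ≠ b₀ → y b = y' b) (j : ℕ) : voteWeight c s y j ≤ c * voteWeight c s y' j := by
  calc voteWeight c s y j ≤ 2⁻¹ ^ (j + 1) * (c : ℝ≥0∞) ^ (voteCount s y' j + 1) := by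
        rw [voteWeight]
        gcongr
        · exact_mod_cast hc
        · exact voteCount_le_succ h j
    _ = c * voteWeight c s y' j := by rw [voteWeight]; ring

lemma votePMF_apply_le {c : ℝ≥0} (hc : 1 ≤ c) {s : Finset ℕ} {y y' : ℕ → ℕ} {b₀ : ℕ}
    (h : ∀ b, b ≠ b₀ → y b = y' b) (j : ℕ) :
    votePMF c hc s y j ≤ (c : ℝ≥0∞) ^ 2 * votePMF c hc s y' j := by
  have hc0 : (c : ℝ≥0∞) ≠ 0 := by exact_mod_cast (zero_lt_one.trans_le hc).ne'
  have hsum : ∑' i, voteWeight c s y' i ≤ c * ∑' i, voteWeight c s y i := by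
    rw [← ENNReal.tsum_mul_left]
    exact ENNReal.tsum_le_tsum (voteWeight_le hc fun b hb => (h b hb).symm)
  have hinv : (∑' i, voteWeight c s y i)⁻¹ ≤ c * (∑' i, voteWeight c s y' i)⁻¹ := by
    have := ENNReal.inv_le_inv.2 hsum
    rw [ENNReal.mul_inv (Or.inl hc0) (Or.inl ENNReal.coe_ne_top)] at this
    calc (∑' i, voteWeight c s y i)⁻¹
        = c * ((c : ℝ≥0∞)⁻¹ * (∑' i, voteWeight c s y i)⁻¹) := by
          rw [← mul_assoc, ENNReal.mul_inv_cancel hc0 ENNReal.coe_ne_top, one_mul]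
      _ ≤ _ := by gcongr
  rw [votePMF, votePMF, PMF.normalize_apply, PMF.normalize_apply]
  calc _ ≤ (c * voteWeight c s y' j) * (c * (∑' i, voteWeight c s y' i)⁻¹) :=
        mul_le_mul' (voteWeight_le hc h j) hinv
    _ = _ := by ring

lemma votePMF_toMeasure_le {c : ℝ≥0} (hc : 1 ≤ c) {s : Finset ℕ} {y y' : ℕ → ℕ} {b₀ : ℕ}
    (h : ∀ b, b ≠ b₀ → y b = y' b) :
    (votePMF c hc s y).toMeasure ≤ (c : ℝ≥0∞) ^ 2 • (votePMF c hc s y').toMeasure := by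
  refine Measure.le_iff.2 fun E hE => ?_
  rw [Measure.smul_apply, smul_eq_mul, PMF.toMeasure_apply _ hE, PMF.toMeasure_apply _ hE,
    ← ENNReal.tsum_mul_left]
  refine ENNReal.tsum_le_tsum fun j => ?_
  by_cases hj : j ∈ E
  · simpa [hj] using votePMF_apply_le hc h j
  · simp [hj]

/-- If all voters agree on `i`, the mechanism errs with exponentially small probability. -/
lemma votePMF_toMeasure_compl_le {c : ℝ≥0} (hc : 1 ≤ c) {s : Finset ℕ} {y : ℕ → ℕ} {i : ℕ}
    (h : ∀ b ∈ s, y b = i) :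
    (votePMF c hc s y).toMeasure {i}ᶜ ≤ 2 ^ (i + 1) * (c : ℝ≥0∞)⁻¹ ^ s.card := by
  have hc0 : (c : ℝ≥0∞) ≠ 0 := by exact_mod_cast (zero_lt_one.trans_le hc).ne'
  have hi : voteWeight c s y i = 2⁻¹ ^ (i + 1) * (c : ℝ≥0∞) ^ s.card := by
    rw [voteWeight, voteCount, Finset.filter_true_of_mem h]
  have hZ : (∑' j, voteWeight c s y j)⁻¹ ≤ 2 ^ (i + 1) * (c : ℝ≥0∞)⁻¹ ^ s.card := by
    refine (ENNReal.inv_le_inv.2 (ENNReal.le_tsum i)).trans_eq ?_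
    rw [hi, ENNReal.mul_inv (Or.inr (by finiteness)) (Or.inr (pow_ne_zero _ hc0)),
      ENNReal.inv_pow, inv_inv, ENNReal.inv_pow]
  rw [PMF.toMeasure_apply _ (MeasurableSet.singleton i).compl]
  calc ∑' j, ({i}ᶜ : Set ℕ).indicator (votePMF c hc s y) j
      ≤ ∑' j : ℕ, 2⁻¹ ^ (j + 1) * (∑' j, voteWeight c s y j)⁻¹ := by
        refine ENNReal.tsum_le_tsum fun j => ?_
        by_cases hj : j = i
        · simp [hj]
        · have h0 : voteCount s y j = 0 := by
            rw [voteCount, Finset.card_eq_zero, Finset.filter_eq_empty_iff]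
            intro b hb hbj
            exact hj (hbj ▸ h b hb)
          rw [Set.indicator_of_mem (by simpa using hj), votePMF, PMF.normalize_apply]
          simp [voteWeight, h0]
    _ = (∑' j, voteWeight c s y j)⁻¹ := by
        rw [ENNReal.tsum_mul_right, tsum_two_inv_pow_succ, one_mul]
    _ ≤ _ := hZ

/-! ### Voting by tell-tales -/

/-- The least index consistent with the sample `S` whose tell-tale lies in `S`. -/
noncomputable def tellTaleVote (L : ℕ → Set ℕ) (T : ℕ → Finset ℕ) (S : Finset ℕ) : ℕ :=
  sInf {j | T j ⊆ S ∧ ↑S ⊆ L j}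

lemma exists_locking_set {L : ℕ → Set ℕ} {T : ℕ → Finset ℕ} (hTL : ∀ i, ↑(T i) ⊆ L i)
    (hT : ∀ i j, ↑(T i) ⊆ L j → ¬ (L j ⊂ L i)) (i : ℕ) :
    ∃ i₀, L i₀ = L i ∧ ∃ F : Finset ℕ, ↑F ⊆ L i ∧
      ∀ S : Finset ℕ, F ⊆ S → ↑S ⊆ L i → tellTaleVote L T S = i₀ := by
  classical
  have hex : ∃ j, L j = L i := ⟨i, rfl⟩
  have hY : ∀ j, ∃ Y : Finset ℕ, ↑Y ⊆ L i ∧ (↑Y ⊆ L j → L i ⊆ L j) := by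
    intro j
    by_cases hj : L i ⊆ L j
    · exact ⟨∅, by simp, fun _ => hj⟩
    · obtain ⟨y, hyi, hyj⟩ := Set.not_subset.1 hj
      exact ⟨{y}, by simpa using hyi, fun h => absurd (by simpa using h) hyj⟩
  choose Y hYi hYj using hY
  have hi₀ : L (Nat.find hex) = L i := Nat.find_spec hex
  refine ⟨Nat.find hex, hi₀, T (Nat.find hex) ∪ (Finset.range (Nat.find hex)).biUnion Y, ?_, ?_⟩
  · intro y hy
    simp only [Finset.coe_union, Set.mem_union, Finset.mem_coe, Finset.mem_biUnion] at hy
    rcases hy with hy | ⟨j, -, hy⟩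
    · exact hi₀ ▸ hTL _ hy
    · exact hYi j hy
  · intro S hFS hS
    have hmem : Nat.find hex ∈ {j | T j ⊆ S ∧ ↑S ⊆ L j} :=
      ⟨Finset.subset_union_left.trans hFS, by rwa [hi₀]⟩
    refine le_antisymm (Nat.sInf_le hmem) (le_csInf ⟨_, hmem⟩ ?_)
    rintro j ⟨hTj, hSj⟩
    by_contra! hlt
    have hYS : Y j ⊆ S :=
      (Finset.subset_biUnion_of_mem Y (Finset.mem_range.2 hlt)).trans
        (Finset.subset_union_right.trans hFS)
    have hij : L i ⊆ L j := hYj j ((Finset.coe_subset.2 hYS).trans hSj)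
    have hTi : ↑(T j) ⊆ L i := (Finset.coe_subset.2 hTj).trans hS
    have hne : L j ≠ L i := Nat.find_min hex hlt
    exact hT j i hTi (hij.ssubset_of_ne hne.symm)

/-! ### Measurability and product measures -/

/-- A function of finitely many coordinates of a stream is measurable. -/
lemma measurable_of_forall_prefix {β : Type*} [MeasurableSpace β] {f : (ℕ → ℕ) → β} (n : ℕ)
    (h : ∀ x x' : ℕ → ℕ, (∀ m < n, x m = x' m) → f x = f x') : Measurable f := by
  have hf : f = (fun y : Fin n → ℕ => f fun m => if hm : m < n then y ⟨m, hm⟩ else 0) ∘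
      fun (x : ℕ → ℕ) (m : Fin n) => x m := by
    funext x
    exact h _ _ fun m hm => by simp [hm]
  rw [hf]
  exact (measurable_of_countable _).comp (by fun_prop)

lemma measurable_infinitePi {α : Type*} [MeasurableSpace α] {P : α → ℕ → Measure ℕ}
    [∀ x k, IsProbabilityMeasure (P x k)] (hP : ∀ k (t : Set ℕ), Measurable fun x => P x k t) :
    Measurable fun x => Measure.infinitePi (P x) := by
  refine Measurable.measure_of_isPiSystem_of_isProbabilityMeasure
    (generateFrom_squareCylinders (α := fun _ : ℕ => ℕ)).symm
    (isPiSystem_squareCylinders (fun _ => MeasurableSpace.isPiSystem_measurableSet)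
      fun _ => Set.mem_ofPred.2 MeasurableSet.univ) ?_
  rintro _ ⟨s, t, ht, rfl⟩
  have ht' : ∀ k ∈ s, MeasurableSet (t k) := fun k _ => ht k trivial
  simp_rw [Measure.infinitePi_pi _ ht']
  exact Finset.measurable_prod _ fun k _ => hP k _

lemma measurable_update_coordinate (k₀ : ℕ) :
    Measurable fun p : ℕ × (ℕ → ℕ) => Function.update p.2 k₀ p.1 := by
  refine measurable_pi_lambda _ fun k => ?_
  by_cases hk : k = k₀
  · subst hk
    simpa using measurable_fst
  · simp only [Function.update_of_ne hk]
    fun_prop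

/-- A product measure splits off any of its coordinates. -/
lemma map_update_prod_infinitePi (μ ν : ℕ → Measure ℕ) [∀ k, IsProbabilityMeasure (μ k)]
    [∀ k, IsProbabilityMeasure (ν k)] (k₀ : ℕ) (h : ∀ k, k ≠ k₀ → μ k = ν k) :
    ((μ k₀).prod (Measure.infinitePi ν)).map
      (fun p : ℕ × (ℕ → ℕ) => Function.update p.2 k₀ p.1) = Measure.infinitePi μ := by
  refine Measure.eq_infinitePi _ fun s t ht => ?_
  rw [Measure.map_apply (measurable_update_coordinate k₀) (.pi s.countable_toSet fun _ _ => ht _)]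
  by_cases hk₀ : k₀ ∈ s
  · have : (fun p : ℕ × (ℕ → ℕ) => Function.update p.2 k₀ p.1) ⁻¹' (s : Set ℕ).pi t
        = t k₀ ×ˢ ((s.erase k₀ : Finset ℕ) : Set ℕ).pi t := by
      ext ⟨a, w⟩
      simp only [Set.mem_preimage, Set.mem_pi, Set.mem_prod, Finset.mem_coe, Finset.mem_erase]
      refine ⟨fun hp => ⟨by simpa using hp k₀ hk₀, fun k hk => ?_⟩, fun hp k hk => ?_⟩
      · simpa [Function.update_of_ne hk.1] using hp k hk.2
      · by_cases hkk : k = k₀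
        · subst hkk
          simpa using hp.1
        · simpa [Function.update_of_ne hkk] using hp.2 k ⟨hkk, hk⟩
    rw [this, Measure.prod_prod, Measure.infinitePi_pi _ fun k _ => ht k,
      ← Finset.mul_prod_erase s _ hk₀]
    congr 1
    exact Finset.prod_congr rfl fun k hk => by rw [h k (Finset.ne_of_mem_erase hk)]
  · have : (fun p : ℕ × (ℕ → ℕ) => Function.update p.2 k₀ p.1) ⁻¹' (s : Set ℕ).pi t
        = Set.univ ×ˢ (s : Set ℕ).pi t := by
      ext ⟨a, w⟩
      simp only [Set.mem_preimage, Set.mem_pi, Set.mem_prod, Finset.mem_coe, Set.mem_univ,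
        true_and]
      refine forall₂_congr fun k hk => ?_
      rw [Function.update_of_ne (ne_of_mem_of_not_mem hk hk₀)]
    rw [this, Measure.prod_prod, Measure.infinitePi_pi _ fun k _ => ht k, measure_univ, one_mul]
    exact Finset.prod_congr rfl fun k hk => by rw [h k (ne_of_mem_of_not_mem hk hk₀)]

lemma infinitePi_le_smul {μ ν : ℕ → Measure ℕ} [∀ k, IsProbabilityMeasure (μ k)]
    [∀ k, IsProbabilityMeasure (ν k)] {k₀ : ℕ} (h : ∀ k, k ≠ k₀ → μ k = ν k) {c : ℝ≥0∞}
    (hle : μ k₀ ≤ c • ν k₀) : Measure.infinitePi μ ≤ c • Measure.infinitePi ν := by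
  have hν := map_update_prod_infinitePi ν ν k₀ fun _ _ => rfl
  calc Measure.infinitePi μ
      = ((μ k₀).prod (Measure.infinitePi ν)).map
          (fun p : ℕ × (ℕ → ℕ) => Function.update p.2 k₀ p.1) :=
        (map_update_prod_infinitePi μ ν k₀ h).symm
    _ ≤ ((c • ν k₀).prod (Measure.infinitePi ν)).map
          (fun p : ℕ × (ℕ → ℕ) => Function.update p.2 k₀ p.1) :=
        Measure.map_mono (Measure.prod_mono hle le_rfl) (measurable_update_coordinate k₀)
    _ = c • Measure.infinitePi ν := by rw [Measure.prod_smul_left, Measure.map_smul, hν]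

/-! ### Independent and identically distributed streams -/

lemma IsIIDStream.eq_infinitePi {D : PMF ℕ} {μ : Measure (ℕ → ℕ)} (h : IsIIDStream D μ) :
    μ = Measure.infinitePi fun _ => D.toMeasure := by
  have := h.1
  have key : ∀ n : ℕ, μ.map (fun x (m : Fin n) => x m) =
      (Measure.infinitePi fun _ : ℕ => D.toMeasure).map (fun x (m : Fin n) => x m) := by
    intro n
    refine Measure.ext_of_singleton fun y => ?_
    have hpre : (fun (x : ℕ → ℕ) (m : Fin n) => x m) ⁻¹' {y} =
        {x | ∀ m : Fin n, x m.val = y m} := by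
      ext x
      simp [funext_iff]
    have hpi : {x : ℕ → ℕ | ∀ m : Fin n, x m.val = y m} = ((Finset.range n : Finset ℕ) : Set ℕ).pi
        fun m => {if hm : m < n then y ⟨m, hm⟩ else 0} := by
      ext x
      simp only [Set.mem_ofPred_eq, Set.mem_pi, Finset.mem_coe, Finset.mem_range,
        Set.mem_singleton_iff]
      exact ⟨fun hx m hm => by simpa [hm] using hx ⟨m, hm⟩,
        fun hx m => by simpa using hx m m.2⟩
    rw [Measure.map_apply (by fun_prop) (.singleton y),
      Measure.map_apply (by fun_prop) (.singleton y), hpre, h.2, hpi,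
      Measure.infinitePi_pi _ fun _ _ => .singleton _, Finset.prod_range]
    refine Finset.prod_congr rfl fun m _ => ?_
    rw [PMF.toMeasure_apply_singleton _ _ (.singleton _)]
    simp
  refine Measure.eq_infinitePi _ fun s t ht => ?_
  obtain ⟨n, hn⟩ : ∃ n, ∀ m ∈ s, m < n :=
    ⟨s.sup id + 1, fun m hm => Nat.lt_succ_of_le (Finset.le_sup (f := id) hm)⟩
  have hpre : (s : Set ℕ).pi t =
      (fun (x : ℕ → ℕ) (m : Fin n) => x m) ⁻¹' {y | ∀ m : Fin n, m.val ∈ s → y m ∈ t m} := by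
    ext x
    exact ⟨fun hx m hm => hx m hm, fun hx m hm => hx ⟨m, hn m hm⟩ hm⟩
  rw [← Measure.infinitePi_pi _ fun k _ => ht k, hpre,
    ← Measure.map_apply (by fun_prop) (Set.to_countable _).measurableSet, key,
    Measure.map_apply (by fun_prop) (Set.to_countable _).measurableSet]

lemma IsIIDStream.ae_mem_support {D : PMF ℕ} {μ : Measure (ℕ → ℕ)} (h : IsIIDStream D μ) :
    ∀ᵐ x ∂μ, ∀ m, x m ∈ D.support := by
  rw [h.eq_infinitePi, ae_all_iff]
  intro m
  have := (measurePreserving_eval_infinitePi (fun _ : ℕ => D.toMeasure) m).quasiMeasurePreserving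
  refine this.ae (p := fun a => a ∈ D.support) ?_
  rw [ae_iff, D.toMeasure_apply_eq_zero_iff (Set.to_countable _).measurableSet]
  exact Set.disjoint_left.2 fun a ha hna => hna ha

/-- Almost surely, all but finitely many blocks contain a given support point. -/
lemma IsIIDStream.ae_eventually_mem_image_sqrtBlock {D : PMF ℕ} {μ : Measure (ℕ → ℕ)}
    (h : IsIIDStream D μ) {a : ℕ} (ha : a ∈ D.support) :
    ∀ᵐ x ∂μ, ∀ᶠ b in atTop, a ∈ (sqrtBlock b).image x := by
  set q : ℝ≥0∞ := D.toMeasure {a}ᶜ with hq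
  have hq1 : q < 1 := by
    rw [hq, prob_compl_eq_one_sub (.singleton a), PMF.toMeasure_apply_singleton _ _ (.singleton a)]
    exact ENNReal.sub_lt_self ENNReal.one_ne_top one_ne_zero ((D.mem_support_iff a).1 ha)
  have hmiss : ∀ b, μ {x | a ∉ (sqrtBlock b).image x} ≤ q ^ b := by
    intro b
    have : {x : ℕ → ℕ | a ∉ (sqrtBlock b).image x} =
        ((sqrtBlock b : Finset ℕ) : Set ℕ).pi fun _ => {a}ᶜ := by
      ext x
      simp [Set.mem_pi]
    rw [this, h.eq_infinitePi, Measure.infinitePi_pi _ fun _ _ => (MeasurableSet.singleton a).compl,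
      Finset.prod_const, card_sqrtBlock]
    exact pow_le_pow_right_of_le_one' hq1.le (by omega)
  have hsum : ∑' b, μ {x | a ∉ (sqrtBlock b).image x} ≠ ∞ := by
    refine ne_top_of_le_ne_top ?_ (ENNReal.tsum_le_tsum hmiss)
    rw [ENNReal.tsum_geometric]
    exact ENNReal.inv_ne_top.2 (tsub_pos_of_lt hq1).ne'
  filter_upwards [ae_eventually_notMem hsum] with x hx
  filter_upwards [hx] with b hb
  simpa using hb

/-! ### The private identification algorithm -/

/-- The vote of the `b`-th block of the stream `x`. -/
noncomputable def blockVote (L : ℕ → Set ℕ) (T : ℕ → Finset ℕ) (x : ℕ → ℕ) (b : ℕ) : ℕ :=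
  tellTaleVote L T ((sqrtBlock b).image x)

lemma blockVote_congr {L : ℕ → Set ℕ} {T : ℕ → Finset ℕ} {x x' : ℕ → ℕ} {b : ℕ}
    (h : ∀ m, Nat.sqrt m = b → x m = x' m) : blockVote L T x b = blockVote L T x' b := by
  rw [blockVote, blockVote, Finset.image_congr fun m hm => h m (mem_sqrtBlock.1 hm)]

/-- The law of the guess at stage `k`: a private election among the blocks of that stage. -/
noncomputable def stageLaw (L : ℕ → Set ℕ) (T : ℕ → Finset ℕ) (c : ℝ≥0) (hc : 1 ≤ c)
    (x : ℕ → ℕ) (k : ℕ) : Measure ℕ :=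
  (votePMF c hc (sqrtBlock k) (blockVote L T x)).toMeasure

instance (L : ℕ → Set ℕ) (T : ℕ → Finset ℕ) (c : ℝ≥0) (hc : 1 ≤ c) (x : ℕ → ℕ) (k : ℕ) :
    IsProbabilityMeasure (stageLaw L T c hc x k) :=
  PMF.toMeasure.isProbabilityMeasure _

/-- The algorithm that outputs at each time the guess of the last completed stage, guesses at
different stages being independent. -/
noncomputable def privateIdentifier (L : ℕ → Set ℕ) (T : ℕ → Finset ℕ) (c : ℝ≥0) (hc : 1 ≤ c)
    (x : ℕ → ℕ) : Measure (ℕ → ℕ) :=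
  (Measure.infinitePi (stageLaw L T c hc x)).map fun g t => g (stage t)

section

variable {L : ℕ → Set ℕ} {T : ℕ → Finset ℕ} {c : ℝ≥0} {hc : 1 ≤ c}

lemma stageLaw_congr {x x' : ℕ → ℕ} {k : ℕ}
    (h : ∀ m, Nat.sqrt (Nat.sqrt m) = k → x m = x' m) :
    stageLaw L T c hc x k = stageLaw L T c hc x' k := by
  rw [stageLaw, stageLaw, votePMF_congr hc fun b hb => blockVote_congr fun m hm =>
    h m (by rw [hm]; exact mem_sqrtBlock.1 hb)]

instance (x : ℕ → ℕ) : IsProbabilityMeasure (privateIdentifier L T c hc x) :=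
  Measure.isProbabilityMeasure_map (Measurable.aemeasurable (by fun_prop))

lemma measurable_privateIdentifier : Measurable (privateIdentifier L T c hc) := by
  refine (Measure.measurable_map _ (by fun_prop)).comp (measurable_infinitePi fun k t => ?_)
  refine measurable_of_forall_prefix (((k + 1) ^ 2) ^ 2) fun x x' h => ?_
  rw [stageLaw_congr fun m hm => h m ?_]
  rw [← Nat.sqrt_lt', ← Nat.sqrt_lt']
  omega

lemma prefixCausal_privateIdentifier : PrefixCausal (privateIdentifier L T c hc) := by
  intro x x' n h
  set I : Finset ℕ := (Finset.range n).image stage with hI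
  have key : ∀ z, (privateIdentifier L T c hc z).map (fun w (m : Fin n) => w m.val) =
      (Measure.pi fun k : I => stageLaw L T c hc z k).map fun g (m : Fin n) =>
        g ⟨stage m, Finset.mem_image_of_mem _ (Finset.mem_range.2 m.2)⟩ := by
    intro z
    rw [privateIdentifier, Measure.map_map (by fun_prop) (by fun_prop),
      ← Measure.infinitePi_map_restrict, Measure.map_map (by fun_prop) (by fun_prop)]
    rfl
  have heq : (fun k : I => stageLaw L T c hc x k) = fun k : I => stageLaw L T c hc x' k := by
    funext ⟨k, hk⟩
    obtain ⟨t, ht, rfl⟩ := Finset.mem_image.1 hk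
    exact stageLaw_congr fun m hm =>
      h m ((le_of_sqrt_sqrt_eq_stage hm).trans_lt (Finset.mem_range.1 ht))
  rw [key, key]
  simp only [heq]

lemma privateIdentifier_le {x x' : ℕ → ℕ} (h : Neighboring x x') :
    privateIdentifier L T c hc x ≤ (c : ℝ≥0∞) ^ 2 • privateIdentifier L T c hc x' := by
  obtain ⟨j, -, hj⟩ := h
  rw [privateIdentifier, privateIdentifier, ← Measure.map_smul]
  refine Measure.map_mono (infinitePi_le_smul (k₀ := Nat.sqrt (Nat.sqrt j)) (fun k hk => ?_) ?_)
    (by fun_prop)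
  · refine stageLaw_congr fun m hm => hj m ?_
    rintro rfl
    exact hk hm.symm
  · refine votePMF_toMeasure_le hc (b₀ := Nat.sqrt j) fun b hb => blockVote_congr fun m hm =>
      hj m ?_
    rintro rfl
    exact hb hm.symm

lemma ae_eventually_eq_of_eventually_blockVote_eq (hc1 : 1 < c) {x : ℕ → ℕ} {i : ℕ}
    (h : ∀ᶠ b in atTop, blockVote L T x b = i) :
    ∀ᵐ w ∂privateIdentifier L T c hc x, ∀ᶠ n in atTop, w n = i := by
  obtain ⟨B, hB⟩ := eventually_atTop.1 h
  have herr : ∀ k, Measure.infinitePi (stageLaw L T c hc x) {g | g (k + B) ≠ i} ≤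
      2 ^ (i + 1) * (c : ℝ≥0∞)⁻¹ ^ k := by
    intro k
    have hpre : {g : ℕ → ℕ | g (k + B) ≠ i} = (fun g => g (k + B)) ⁻¹' {i}ᶜ := rfl
    rw [hpre, ← Measure.map_apply (by fun_prop) (MeasurableSet.singleton i).compl,
      Measure.infinitePi_map_eval]
    refine (votePMF_toMeasure_compl_le hc fun b hb => hB b ?_).trans ?_
    · have := Nat.sqrt_le_self b
      rw [mem_sqrtBlock.1 hb] at this
      omega
    · gcongr 2 ^ (i + 1) * ?_
      rw [card_sqrtBlock]
      refine pow_le_pow_right_of_le_one' (ENNReal.inv_le_one.2 (by exact_mod_cast hc)) (by omega)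
  have hsum : ∑' k, Measure.infinitePi (stageLaw L T c hc x) {g | g (k + B) ≠ i} ≠ ∞ := by
    refine ne_top_of_le_ne_top ?_ (ENNReal.tsum_le_tsum herr)
    rw [ENNReal.tsum_mul_left, ENNReal.tsum_geometric]
    refine ENNReal.mul_ne_top (by finiteness) (ENNReal.inv_ne_top.2 (tsub_pos_of_lt ?_).ne')
    exact ENNReal.inv_lt_one.2 (by exact_mod_cast hc1)
  have hmeas : MeasurableSet {w : ℕ → ℕ | ∀ᶠ n in atTop, w n = i} := by
    simp only [eventually_atTop]
    measurability
  rw [privateIdentifier, ae_map_iff (Measurable.aemeasurable (by fun_prop)) hmeas]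
  filter_upwards [ae_eventually_notMem hsum] with g hg
  refine tendsto_stage.eventually (p := fun k => g k = i) ?_
  rw [← map_add_atTop_eq_nat B, eventually_map]
  simpa using hg

end

/-- Every countable collection of infinite languages satisfying
Angluin's condition admits, for every ε > 0, a prefix-causal ε-DP
continual-release algorithm identifying it in the limit from stochastic
inputs. -/
theorem stmt14 (L : ℕ → Set ℕ) (hL : ∀ i, (L i).Infinite)
    (hAngluin : AngluinCondition L) (ε : ℝ) (hε : 0 < ε) :
    ∃ A : (ℕ → ℕ) → Measure (ℕ → ℕ),
      (∀ x, IsProbabilityMeasure (A x)) ∧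
      (∀ E : Set (ℕ → ℕ), MeasurableSet E → Measurable fun x => A x E) ∧
      PrefixCausal A ∧ DPCR ε A ∧ IdentifiesStochastically L A := by
  choose T hTL hT using hAngluin
  set c : ℝ≥0 := Real.toNNReal (Real.exp (ε / 2)) with hcdef
  have hc1 : 1 < c := by
    rw [hcdef, Real.lt_toNNReal_iff_coe_lt]
    simpa using hε
  have hcε : (c : ℝ≥0∞) ^ 2 = ENNReal.ofReal (Real.exp ε) := by
    have : (c : ℝ≥0∞) = ENNReal.ofReal (Real.exp (ε / 2)) := rfl
    rw [this, ← ENNReal.ofReal_pow (Real.exp_nonneg _), ← Real.exp_nat_mul]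
    congr 2
    push_cast
    ring
  refine ⟨privateIdentifier L T c hc1.le, fun x => inferInstance,
    fun E hE => (Measure.measurable_coe hE).comp measurable_privateIdentifier,
    prefixCausal_privateIdentifier, fun x x' h E _ => ?_, fun i D hD μ hμ => ?_⟩
  · rw [← hcε]
    exact privateIdentifier_le h E
  · have := hμ.1
    obtain ⟨i₀, hi₀, F, hFL, hF⟩ := exists_locking_set hTL hT i
    have hFx : ∀ᵐ x ∂μ, ∀ a ∈ F, ∀ᶠ b in atTop, a ∈ (sqrtBlock b).image x :=
      (Finset.eventually_all F).2 fun a ha =>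
        hμ.ae_eventually_mem_image_sqrtBlock (hD ▸ hFL ha)
    have hone : ∀ᵐ x ∂μ, privateIdentifier L T c hc1.le x
        {w | ∃ N : ℕ, ∀ n ≥ N, L (w n) = L i} = 1 := by
      filter_upwards [hFx, hμ.ae_mem_support] with x hx hxD
      have hvote : ∀ᶠ b in atTop, blockVote L T x b = i₀ := by
        filter_upwards [(Finset.eventually_all F).2 hx] with b hb
        refine hF _ hb fun a ha => ?_
        obtain ⟨m, -, rfl⟩ := Finset.mem_image.1 ha
        exact hD ▸ hxD m
      refine (measure_congr (eventuallyEq_univ.2 ?_)).trans measure_univ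
      filter_upwards [ae_eventually_eq_of_eventually_blockVote_eq hc1 hvote] with w hw
      obtain ⟨N, hN⟩ := eventually_atTop.1 hw
      exact ⟨N, fun n hn => by rw [hN n hn, hi₀]⟩
    rw [lintegral_congr_ae hone]
    simp
end

section
/- Let L_1, …, L_k be infinite subsets of ℕ, fix i* ∈ {1,…,k}, let x : Fin n → ℕ be injective with range contained in L_{i*}, let ε > 0 and φ ∈ ℝ, and for S ⊆ {1,…,k} define the weight w(S) = exp((ε/2)·(|Cl(S) ∩ range(x)| + φ·|S|)), where Cl(S) = ⋂_{i ∈ S} L_i (with Cl(∅) = ℕ). Then the sum of w(S) over all conservative sets S (those with i* ∉ S and Cl(S ∪ {i*}) infinite) is at most exp(−ε·φ/2) times the sum of w(S) over all good sets S (those with i* ∈ S and Cl(S) infinite). -/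
/-- The closure of a subcollection: the intersection of its languages
(with `Cl L ∅ = Set.univ`). -/
def Cl {k : ℕ} (L : Fin k → Set ℕ) (S : Finset (Fin k)) : Set ℕ := ⋂ i ∈ S, L i

/-- `d` bounds the closure dimension: every subcollection has closure that is
either infinite or of cardinality at most `d`. -/
def IsClosureBound {k : ℕ} (L : Fin k → Set ℕ) (d : ℤ) : Prop :=
  ∀ S : Finset (Fin k), (Cl L S).Infinite ∨ ((Cl L S).ncard : ℤ) ≤ d

/-- The closure dimension of the collection `L` is the smallest
`d ∈ {-1} ∪ ℕ` that bounds it. -/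
def HasClosureDim {k : ℕ} (L : Fin k → Set ℕ) (d : ℤ) : Prop :=
  IsClosureBound L d ∧ ∀ d' : ℤ, -1 ≤ d' → IsClosureBound L d' → d ≤ d'

open Classical

theorem Cl_insert {k : ℕ} (L : Fin k → Set ℕ) (i : Fin k) (S : Finset (Fin k)) :
    Cl L (insert i S) = L i ∩ Cl L S := by
  simp [Cl]

theorem Cl_insert_inter_of_subset {k : ℕ} (L : Fin k → Set ℕ) {i : Fin k} {A : Set ℕ}
    (hA : A ⊆ L i) (S : Finset (Fin k)) : Cl L (insert i S) ∩ A = Cl L S ∩ A := by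
  rw [Cl_insert, Set.inter_right_comm, Set.inter_eq_right.mpr hA, Set.inter_comm]

/-- With weights
`w(S) = exp((ε/2)·(|Cl(S) ∩ range x| + φ·|S|))`, the total weight of the
conservative sets (`i* ∉ S` and `Cl(S ∪ {i*})` infinite) is at most
`exp(−ε·φ/2)` times the total weight of the good sets (`i* ∈ S` and `Cl(S)`
infinite). -/
theorem stmt17 (k n : ℕ) (L : Fin k → Set ℕ) (hL : ∀ i, (L i).Infinite)
    (istar : Fin k) (x : Fin n → ℕ) (hinj : Function.Injective x)
    (hrange : Set.range x ⊆ L istar) (ε φ : ℝ) (hε : 0 < ε) :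
    (∑ S : Finset (Fin k),
        if istar ∉ S ∧ (Cl L (insert istar S)).Infinite then
          Real.exp ((ε / 2) *
            (((Cl L S ∩ Set.range x).ncard : ℝ) + φ * (S.card : ℝ)))
        else 0) ≤
      Real.exp (-(ε * φ) / 2) *
        ∑ S : Finset (Fin k),
          if istar ∈ S ∧ (Cl L S).Infinite then
            Real.exp ((ε / 2) *
              (((Cl L S ∩ Set.range x).ncard : ℝ) + φ * (S.card : ℝ)))
          else 0 := by
  rw [← Finset.sum_filter, ← Finset.sum_filter, Finset.mul_sum]
  set good := Finset.univ.filter fun S : Finset (Fin k) ↦ istar ∈ S ∧ (Cl L S).Infinite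
  set cons := Finset.univ.filter fun S : Finset (Fin k) ↦
    istar ∉ S ∧ (Cl L (insert istar S)).Infinite
  have notMem : ∀ S ∈ cons, istar ∉ S := fun S hS ↦ (Finset.mem_filter.mp hS).2.1
  have injOn : Set.InjOn (insert istar) (cons : Set (Finset (Fin k))) := by
    intro S hS T hT h
    rw [← Finset.erase_insert (notMem S hS), h, Finset.erase_insert (notMem T hT)]
  have image_subset : cons.image (insert istar) ⊆ good := by
    intro T hT
    obtain ⟨S, hS, rfl⟩ := Finset.mem_image.mp hT
    exact Finset.mem_filter.mpr
      ⟨Finset.mem_univ _, Finset.mem_insert_self _ _, (Finset.mem_filter.mp hS).2.2⟩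
  refine le_trans (le_of_eq ?_)
    (Finset.sum_le_sum_of_subset_of_nonneg image_subset fun _ _ _ ↦ by positivity)
  rw [Finset.sum_image injOn]
  refine Finset.sum_congr rfl fun S hS ↦ ?_
  rw [Cl_insert_inter_of_subset L hrange, Finset.card_insert_of_notMem (notMem S hS),
    ← Real.exp_add]
  push_cast
  ring_nf
end

section
/- Let L_1, …, L_k be infinite subsets of ℕ whose collection has closure dimension d ∈ ℕ, let ε > 0, fix i* ∈ {1,…,k}, let x : Fin n → ℕ be injective with range contained in L_{i*}, set φ = (1/k)·(n − d − (2k·log 2)/ε) (natural logarithm), and for S ⊆ {1,…,k} define w(S) = exp((ε/2)·(|Cl(S) ∩ range(x)| + φ·|S|)), where Cl(S) = ⋂_{i ∈ S} L_i (with Cl(∅) = ℕ). Then the total weight of good sets dominates: (Σ_{S good} w(S)) / (Σ_{S ⊆ {1,…,k}} w(S)) ≥ 1 − 4·exp(−ε·(n−d)/(2k)), where S is good if i* ∈ S and Cl(S) is infinite. -/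
open Classical

theorem Cl_singleton {k : ℕ} (L : Fin k → Set ℕ) (i : Fin k) : Cl L {i} = L i := by
  simp [Cl]

theorem Cl_insert_inter {k : ℕ} (L : Fin k → Set ℕ) {i : Fin k} {R : Set ℕ} (hR : R ⊆ L i)
    (S : Finset (Fin k)) : Cl L (insert i S) ∩ R = Cl L S ∩ R := by
  rw [Cl_insert]
  ext y
  constructor
  · rintro ⟨⟨_, hy⟩, hyR⟩
    exact ⟨hy, hyR⟩
  · rintro ⟨hy, hyR⟩
    exact ⟨⟨hR hyR, hy⟩, hyR⟩

/-- If `Cl L (insert i S)` is finite, at most `d` points of `R ⊆ L i` lie in `Cl L S`. -/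
theorem IsClosureBound.ncard_inter_le {k : ℕ} {L : Fin k → Set ℕ} {d : ℕ}
    (hd : IsClosureBound L d) {i : Fin k} {R : Set ℕ} (hR : R ⊆ L i) {S : Finset (Fin k)}
    (hS : ¬ (Cl L (insert i S)).Infinite) : (Cl L S ∩ R).ncard ≤ d := by
  have hcard : (Cl L (insert i S)).ncard ≤ d := by
    exact_mod_cast (hd (insert i S)).resolve_left hS
  rw [← Cl_insert_inter L hR S]
  exact (Set.ncard_le_ncard Set.inter_subset_left (Set.not_infinite.mp hS)).trans hcard

/-- The sets avoiding `i` whose extension by `i` satisfies `P` weigh at most `b` times the sets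
containing `i` that satisfy `P`, if adding `i` multiplies the weight by at least `b⁻¹`. -/
theorem sum_filter_notMem_le_mul_sum_filter_mem {ι : Type*} [Fintype ι] [DecidableEq ι]
    {w : Finset ι → ℝ} (hw : ∀ S, 0 ≤ w S) {b : ℝ} (hb : 0 ≤ b) (i : ι) (P : Finset ι → Prop)
    (hins : ∀ S, i ∉ S → w S ≤ b * w (insert i S)) :
    ∑ S with i ∉ S ∧ P (insert i S), w S ≤ b * ∑ S with i ∈ S ∧ P S, w S := by
  have hinj : Set.InjOn (insert i)
      (↑({S | i ∉ S ∧ P (insert i S)} : Finset (Finset ι)) : Set (Finset ι)) := by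
    intro S hS T hT h
    simp only [Finset.coe_filter, Finset.mem_univ, true_and, Set.mem_ofPred_eq] at hS hT
    rw [← Finset.erase_insert hS.1, ← Finset.erase_insert hT.1, h]
  calc ∑ S with i ∉ S ∧ P (insert i S), w S
      ≤ ∑ S with i ∉ S ∧ P (insert i S), b * w (insert i S) :=
        Finset.sum_le_sum fun S hS => hins S (Finset.mem_filter.mp hS).2.1
    _ = b * ∑ S ∈ ({S | i ∉ S ∧ P (insert i S)} : Finset (Finset ι)).image (insert i), w S := by
        rw [Finset.sum_image hinj, Finset.mul_sum]
    _ ≤ b * ∑ S with i ∈ S ∧ P S, w S := by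
        refine mul_le_mul_of_nonneg_left
          (Finset.sum_le_sum_of_subset_of_nonneg ?_ fun S _ _ => hw S) hb
        intro T hT
        obtain ⟨S, hS, rfl⟩ := Finset.mem_image.mp hT
        exact Finset.mem_filter.mpr
          ⟨Finset.mem_univ _, Finset.mem_insert_self _ _, (Finset.mem_filter.mp hS).2.2⟩

/-- Splitting all sets into good, conservative and bad ones. -/
theorem sum_eq_good_add_conservative_add_bad {ι : Type*} [Fintype ι] [DecidableEq ι]
    (w : Finset ι → ℝ) (i : ι) (P : Finset ι → Prop) :
    ∑ S, w S = ∑ S with i ∈ S ∧ P S, w S + ∑ S with i ∉ S ∧ P (insert i S), w S +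
      ∑ S with ¬ P (insert i S), w S := by
  simp only [Finset.sum_filter]
  rw [← Finset.sum_add_distrib, ← Finset.sum_add_distrib]
  refine Finset.sum_congr rfl fun S _ => ?_
  by_cases hi : i ∈ S
  · by_cases hP : P S <;> simp [hi, hP]
  · by_cases hP : P (insert i S) <;> simp [hi, hP]

/-- utility of the exponential mechanism for uniform private
generation: with `φ = (1/k)·(n − d − (2k·log 2)/ε)` and weights
`w(S) = exp((ε/2)·(|Cl(S) ∩ range x| + φ·|S|))`, the total weight of the good
sets (`i* ∈ S` and `Cl(S)` infinite) is at least a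
`1 − 4·exp(−ε·(n−d)/(2k))` fraction of the total weight of all sets. -/
theorem stmt18 (k n : ℕ) (hk : 0 < k) (L : Fin k → Set ℕ)
    (hL : ∀ i, (L i).Infinite) (d : ℕ) (hdim : HasClosureDim L (d : ℤ))
    (ε : ℝ) (hε : 0 < ε) (istar : Fin k) (x : Fin n → ℕ)
    (hinj : Function.Injective x) (hrange : Set.range x ⊆ L istar) :
    1 - 4 * Real.exp (-(ε * ((n : ℝ) - (d : ℝ))) / (2 * k)) ≤
      (∑ S : Finset (Fin k),
          if istar ∈ S ∧ (Cl L S).Infinite then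
            Real.exp ((ε / 2) * (((Cl L S ∩ Set.range x).ncard : ℝ) +
              ((1 / (k : ℝ)) * ((n : ℝ) - (d : ℝ) - (2 * k * Real.log 2) / ε)) *
                (S.card : ℝ)))
          else 0) /
        ∑ S : Finset (Fin k),
          Real.exp ((ε / 2) * (((Cl L S ∩ Set.range x).ncard : ℝ) +
            ((1 / (k : ℝ)) * ((n : ℝ) - (d : ℝ) - (2 * k * Real.log 2) / ε)) *
              (S.card : ℝ))) := by
  have hk' : (0 : ℝ) < k := by exact_mod_cast hk
  set φ : ℝ := (1 / (k : ℝ)) * ((n : ℝ) - (d : ℝ) - (2 * k * Real.log 2) / ε) with hφ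
  set w : Finset (Fin k) → ℝ := fun S =>
    Real.exp ((ε / 2) * (((Cl L S ∩ Set.range x).ncard : ℝ) + φ * (S.card : ℝ))) with hw
  set t : ℝ := Real.exp (-(ε * ((n : ℝ) - (d : ℝ))) / (2 * k)) with ht
  have ht0 : 0 < t := Real.exp_pos _
  have hwpos : ∀ S, 0 < w S := fun S => Real.exp_pos _
  have hstep : 2 * t = Real.exp (-(ε / 2 * φ)) := by
    rw [ht, ← Real.exp_log (show (0 : ℝ) < 2 by norm_num), ← Real.exp_add,
      Real.exp_log (show (0 : ℝ) < 2 by norm_num), hφ]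
    congr 1
    field_simp
    ring
  rw [← Finset.sum_filter]
  change 1 - 4 * t ≤ (∑ S with istar ∈ S ∧ (Cl L S).Infinite, w S) / ∑ S, w S
  set G : ℝ := ∑ S with istar ∈ S ∧ (Cl L S).Infinite, w S with hG
  have hG0 : 0 ≤ G := Finset.sum_nonneg fun S _ => (hwpos S).le
  have hT0 : 0 < ∑ S, w S := Finset.sum_pos (fun S _ => hwpos S) Finset.univ_nonempty
  rcases le_or_gt (1 / 4) t with ht4 | ht4
  · exact le_trans (by linarith) (div_nonneg hG0 hT0.le)
  have hφ0 : 0 ≤ φ := by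
    have h : Real.exp (-(ε / 2 * φ)) < 1 := by linarith
    rw [Real.exp_lt_one_iff] at h
    nlinarith
  have hcons : ∑ S with istar ∉ S ∧ (Cl L (insert istar S)).Infinite, w S ≤ 2 * t * G := by
    refine sum_filter_notMem_le_mul_sum_filter_mem (fun S => (hwpos S).le) (by positivity) istar
      (fun S => (Cl L S).Infinite) fun S hS => le_of_eq ?_
    simp only [hw]
    rw [hstep, ← Real.exp_add, Cl_insert_inter L hrange, Finset.card_insert_of_notMem hS]
    congr 1
    push_cast
    ring
  have hsingle : 2 * t * w {istar} = Real.exp (ε / 2 * n) := by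
    have hn : (Set.range x).ncard = n := by
      rw [← Set.image_univ, Set.ncard_image_of_injective _ hinj, Set.ncard_univ, Nat.card_fin]
    simp only [hw]
    rw [hstep, ← Real.exp_add, Cl_singleton, Set.inter_eq_right.mpr hrange, hn]
    congr 1
    simp
    ring
  have hsingle_le : w {istar} ≤ G := by
    refine Finset.single_le_sum (f := w) (fun S _ => (hwpos S).le) ?_
    simp [Cl_singleton, hL istar]
  have hbad : ∑ S with ¬ (Cl L (insert istar S)).Infinite, w S ≤ 2 * t * G := by
    have hbound : ∀ S ∈ ({S | ¬ (Cl L (insert istar S)).Infinite} : Finset (Finset (Fin k))),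
        w S ≤ Real.exp (ε / 2 * (d + φ * k)) := by
      intro S hS
      have hc : ((Cl L S ∩ Set.range x).ncard : ℝ) ≤ d := by
        exact_mod_cast hdim.1.ncard_inter_le hrange (Finset.mem_filter.mp hS).2
      have hcard : (S.card : ℝ) ≤ k := by
        exact_mod_cast (Finset.card_le_univ S).trans_eq (Fintype.card_fin k)
      simp only [hw]
      gcongr
    have hnum : ((({S | ¬ (Cl L (insert istar S)).Infinite} :
        Finset (Finset (Fin k))).card : ℕ) : ℝ) ≤ 2 ^ k := by
      have h := Finset.card_le_univ
        ({S | ¬ (Cl L (insert istar S)).Infinite} : Finset (Finset (Fin k)))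
      rw [Fintype.card_finset, Fintype.card_fin] at h
      exact_mod_cast h
    have hexp : (2 : ℝ) ^ k * Real.exp (ε / 2 * (d + φ * k)) = Real.exp (ε / 2 * n) := by
      rw [← Real.exp_log (show (0 : ℝ) < 2 ^ k by positivity), ← Real.exp_add, Real.log_pow, hφ]
      congr 1
      field_simp
      ring
    calc _ ≤ _ := Finset.sum_le_card_nsmul _ _ _ hbound
      _ ≤ 2 ^ k * Real.exp (ε / 2 * (d + φ * k)) := by
        rw [nsmul_eq_mul]
        gcongr
      _ = 2 * t * w {istar} := by rw [hexp, hsingle]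
      _ ≤ 2 * t * G := by gcongr
  have htotal : ∑ S, w S ≤ (1 + 4 * t) * G := by
    rw [sum_eq_good_add_conservative_add_bad w istar fun S => (Cl L S).Infinite]
    linarith
  rw [le_div_iff₀ hT0]
  calc (1 - 4 * t) * ∑ S, w S ≤ (1 - 4 * t) * ((1 + 4 * t) * G) :=
        mul_le_mul_of_nonneg_left htotal (by linarith)
    _ ≤ G := by nlinarith [mul_nonneg (sq_nonneg t) hG0]
end
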